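/- Let X ⊂ ℙ³ be a smooth cubic surface, a ≥ 2 an integer, C a smooth curve linearly equivalent to aH on X, and G an arithmetically Gorenstein set of points on C linearly equivalent to aH_C (so that G is a complete intersection linking m(a) = (3/2)a(a−1)+a general points of X to n(a) = (3/2)a(a−1)+2a general points of X on C). Then the graded minimal free R-resolution of the saturated ideal I_G is 0 → R(−2a−3) → R(−2a) ⊕ R(−a−3)² → R(−a)² ⊕ R(−3) → I_G → 0. -/

import Mathlib

/-!
Common definitions for formalizing "The minimal resolution conjecture for points
on the cubic surface" (arXiv:math/0611137).

We work with `R = k[x₀,x₁,x₂,x₃]`, closed points of `ℙ³` modeled by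
`Projectivization k (Fin 4 → k)`, saturated ideals of sets of points as vanishing
ideals, genericity expressed by a nonempty basic open subset of the configuration
space, and graded minimal free resolutions expressed by explicit homogeneous
matrices whose entries have zero constant term (no nonzero scalar entries).
-/

open MvPolynomial

noncomputable section

/-- The polynomial ring `R = k[x₀,x₁,x₂,x₃]` in four variables over `k`. -/
abbrev R4 (k : Type) [Field k] : Type := MvPolynomial (Fin 4) k

/-- The (closed) points of the projective space `ℙ³` over `k`. -/
abbrev P3 (k : Type) [Field k] : Type := Projectivization k (Fin 4 → k)

variable (k : Type) [Field k]

/-- A polynomial vanishes at a projective point if it vanishes at every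
representative vector of that point. -/
def VanishesAt (f : R4 k) (p : P3 k) : Prop :=
  ∀ (v : Fin 4 → k) (hv : v ≠ 0), Projectivization.mk k v hv = p → eval v f = 0

/-- The saturated homogeneous ideal `I_Z ⊆ R` of a set `Z` of (reduced) points of
`ℙ³`: all polynomials vanishing at every point of `Z`. -/
def pointsIdeal (Zs : Set (P3 k)) : Ideal (R4 k) where
  carrier := {f | ∀ p ∈ Zs, VanishesAt k f p}
  zero_mem' := by
    intro p _ v hv _
    simp
  add_mem' := by
    intro a b ha hb p hp v hv hmk
    have h1 := ha p hp v hv hmk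
    have h2 := hb p hp v hv hmk
    simp [h1, h2]
  smul_mem' := by
    intro c a ha p hp v hv hmk
    have h1 := ha p hp v hv hmk
    simp [smul_eq_mul, h1]

/-- An ideal of `R` is homogeneous if it is generated by homogeneous elements. -/
def IsHomogIdeal (I : Ideal (R4 k)) : Prop :=
  ∃ G : Set (R4 k), (∀ g ∈ G, ∃ d : ℕ, g.IsHomogeneous d) ∧ I = Ideal.span G

/-- Saturation of an ideal with respect to the irrelevant maximal ideal
`(x₀,…,x₃)`. -/
def satIdeal (I : Ideal (R4 k)) : Ideal (R4 k) where
  carrier := {g | ∀ i : Fin 4, ∃ N : ℕ, (X i : R4 k) ^ N * g ∈ I}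
  zero_mem' := by
    intro i
    exact ⟨0, by simp⟩
  add_mem' := by
    intro a b ha hb i
    obtain ⟨N, hN⟩ := ha i
    obtain ⟨M, hM⟩ := hb i
    refine ⟨N + M, ?_⟩
    have h1 : (X i : R4 k) ^ (N + M) * (a + b)
        = X i ^ M * (X i ^ N * a) + X i ^ N * (X i ^ M * b) := by ring
    rw [h1]
    exact Ideal.add_mem _ (Ideal.mul_mem_left _ _ hN) (Ideal.mul_mem_left _ _ hM)
  smul_mem' := by
    intro c a ha i
    obtain ⟨N, hN⟩ := ha i
    refine ⟨N, ?_⟩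
    have h1 : (X i : R4 k) ^ N * (c • a) = c * (X i ^ N * a) := by
      rw [smul_eq_mul]; ring
    rw [h1]
    exact Ideal.mul_mem_left _ _ hN

/-- The colon ideal `(I : J) = {r | r·J ⊆ I}`. -/
def icolon (I J : Ideal (R4 k)) : Ideal (R4 k) where
  carrier := {r | ∀ x ∈ J, r * x ∈ I}
  zero_mem' := by
    intro x hx
    rw [zero_mul]; exact I.zero_mem
  add_mem' := by
    intro a b ha hb x hx
    rw [add_mul]
    exact Ideal.add_mem _ (ha x hx) (hb x hx)
  smul_mem' := by
    intro c a ha x hx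
    rw [smul_eq_mul, mul_assoc]
    exact Ideal.mul_mem_left _ _ (ha x hx)

/-- A smooth cubic surface `X ⊂ ℙ³`: an irreducible homogeneous cubic form with
no singular zero (Jacobian criterion). -/
structure SmoothCubicSurface (k : Type) [Field k] : Type where
  f : MvPolynomial (Fin 4) k
  homog : f.IsHomogeneous 3
  irred : Irreducible f
  smooth : ∀ v : Fin 4 → k, v ≠ 0 → eval v f = 0 →
    ∃ i : Fin 4, eval v (pderiv i f) ≠ 0

/-- A configuration of `t` distinct points lying on `X`. -/
def ConfigOn (S : SmoothCubicSurface k) {t : ℕ} (Z : Fin t → P3 k) : Prop :=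
  Function.Injective Z ∧ ∀ i, VanishesAt k S.f (Z i)

/-- A configuration avoids the (closed locus of the) polynomial `g` on the
product of the affine cones: some choice of representatives does not annihilate `g`. -/
def Avoids {t : ℕ} (g : MvPolynomial (Fin t × Fin 4) k) (Z : Fin t → P3 k) : Prop :=
  ∃ v : Fin t → Fin 4 → k,
    (∀ i, ∃ hv : v i ≠ 0, Projectivization.mk k (v i) hv = Z i) ∧
    eval (fun q : Fin t × Fin 4 => v q.1 q.2) g ≠ 0

/-- `P` holds for a *general* set of `t` points on `X`: it holds on a nonempty
(basic) Zariski-open subset of the family of all sets of `t` points of `X`. -/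
def GeneralPointsSatisfy (S : SmoothCubicSurface k) (t : ℕ)
    (P : (Fin t → P3 k) → Prop) : Prop :=
  ∃ g : MvPolynomial (Fin t × Fin 4) k,
    (∃ Z : Fin t → P3 k, ConfigOn k S Z ∧ Avoids k g Z) ∧
    (∀ Z : Fin t → P3 k, ConfigOn k S Z → Avoids k g Z → P Z)

/-- An admissible entry of a matrix in a graded **minimal** free resolution,
mapping a generator of degree `d` into a generator of degree `e`: the entry is
homogeneous of degree `d - e`, and it is not a nonzero scalar (zero constant
coefficient). -/
def EntryOk (d e : ℕ) (q : R4 k) : Prop :=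
  (q = 0 ∨ ∃ c : ℕ, d = e + c ∧ q.IsHomogeneous c) ∧ coeff 0 q = 0

/-- Integer-degree version of `EntryOk` (for modules with generators of
arbitrary integer degrees). -/
def EntryOkZ (d e : ℤ) (q : R4 k) : Prop :=
  (q = 0 ∨ ∃ c : ℕ, d = e + (c : ℤ) ∧ q.IsHomogeneous c) ∧ coeff 0 q = 0

/-- The body of a graded minimal free resolution of length 2 over `R` of the
`R`-module `I/J`:
`0 → ⊕ R(-d2 i) --M2--> ⊕ R(-d1 j) --g--> I/J → 0`.
The generators `g j ∈ I` are homogeneous of degree `d1 j` and generate `I` mod `J`;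
`M2` is a homogeneous matrix with no nonzero scalar entries whose rows generate the
kernel, and which is injective. -/
def Res2Body (J I : Ideal (R4 k)) {n1 n2 : ℕ}
    (d1 : Fin n1 → ℕ) (d2 : Fin n2 → ℕ)
    (g : Fin n1 → R4 k) (M2 : Fin n2 → Fin n1 → R4 k) : Prop :=
  (∀ j, g j ∈ I ∧ (g j).IsHomogeneous (d1 j)) ∧
  (∀ x ∈ I, ∃ w : Fin n1 → R4 k, x - ∑ j, w j * g j ∈ J) ∧
  (∀ i j, EntryOk k (d2 i) (d1 j) (M2 i j)) ∧
  (∀ w : Fin n1 → R4 k,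
    ((∑ j, w j * g j) ∈ J) ↔ ∃ u : Fin n2 → R4 k, ∀ j, w j = ∑ i, u i * M2 i j) ∧
  (∀ u : Fin n2 → R4 k, (∀ j, (∑ i, u i * M2 i j) = 0) → u = 0)

/-- `I/J` has a graded minimal free resolution
`0 → ⊕ R(-d2 i) → ⊕ R(-d1 j) → I/J → 0` over `R`. -/
def HasMinFreeRes2 (J I : Ideal (R4 k)) {n1 n2 : ℕ}
    (d1 : Fin n1 → ℕ) (d2 : Fin n2 → ℕ) : Prop :=
  ∃ (g : Fin n1 → R4 k) (M2 : Fin n2 → Fin n1 → R4 k), Res2Body k J I d1 d2 g M2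

/-- The body of a graded minimal free resolution of length 3 over `R` of the
`R`-module `I/J`:
`0 → ⊕ R(-d3 l) --M3--> ⊕ R(-d2 i) --M2--> ⊕ R(-d1 j) --g--> I/J → 0`. -/
def Res3Body (J I : Ideal (R4 k)) {n1 n2 n3 : ℕ}
    (d1 : Fin n1 → ℕ) (d2 : Fin n2 → ℕ) (d3 : Fin n3 → ℕ)
    (g : Fin n1 → R4 k) (M2 : Fin n2 → Fin n1 → R4 k)
    (M3 : Fin n3 → Fin n2 → R4 k) : Prop :=
  (∀ j, g j ∈ I ∧ (g j).IsHomogeneous (d1 j)) ∧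
  (∀ x ∈ I, ∃ w : Fin n1 → R4 k, x - ∑ j, w j * g j ∈ J) ∧
  (∀ i j, EntryOk k (d2 i) (d1 j) (M2 i j)) ∧
  (∀ i j, EntryOk k (d3 i) (d2 j) (M3 i j)) ∧
  (∀ w : Fin n1 → R4 k,
    ((∑ j, w j * g j) ∈ J) ↔ ∃ u : Fin n2 → R4 k, ∀ j, w j = ∑ i, u i * M2 i j) ∧
  (∀ u : Fin n2 → R4 k,
    (∀ j, (∑ i, u i * M2 i j) = 0) ↔ ∃ t : Fin n3 → R4 k, ∀ i, u i = ∑ l, t l * M3 l i) ∧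
  (∀ t : Fin n3 → R4 k, (∀ i, (∑ l, t l * M3 l i) = 0) → t = 0)

/-- `I/J` has a graded minimal free resolution
`0 → ⊕ R(-d3 l) → ⊕ R(-d2 i) → ⊕ R(-d1 j) → I/J → 0` over `R`.
Taking `J = ⊥` this is a resolution of the ideal `I ⊆ R`; taking `J = (f)` it is a
resolution of `I/(f) ⊆ R_X = R/(f)`; taking `J = I_C` a resolution of `I/I_C`. -/
def HasMinFreeRes3 (J I : Ideal (R4 k)) {n1 n2 n3 : ℕ}
    (d1 : Fin n1 → ℕ) (d2 : Fin n2 → ℕ) (d3 : Fin n3 → ℕ) : Prop :=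
  ∃ (g : Fin n1 → R4 k) (M2 : Fin n2 → Fin n1 → R4 k) (M3 : Fin n3 → Fin n2 → R4 k),
    Res3Body k J I d1 d2 d3 g M2 M3

/-- The Betti numbers read off from a minimal free resolution
`0 → F₃ → F₂ → F₁ → I_Z → 0` of the ideal of `Z` (so that
`F_i = ⊕_j R(-i-j)^{b_{i,j}}` in the resolution of `R/I_Z`, with `F₀ = R`). -/
def bettiCount {n1 n2 n3 : ℕ} (d1 : Fin n1 → ℕ) (d2 : Fin n2 → ℕ) (d3 : Fin n3 → ℕ)
    (i j : ℕ) : ℕ :=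
  if i = 0 then (if j = 0 then 1 else 0)
  else if i = 1 then (Finset.univ.filter fun l => d1 l = 1 + j).card
  else if i = 2 then (Finset.univ.filter fun l => d2 l = 2 + j).card
  else if i = 3 then (Finset.univ.filter fun l => d3 l = 3 + j).card
  else 0

/-- The Hilbert polynomial `P_X(t) = (3/2)t(t+1) + 1` of the cubic surface. -/
def PXcubic (t : ℕ) : ℕ := 3 * (t * (t + 1) / 2) + 1

/-- The saturated homogeneous ideal of an integral curve lying on `X`. -/
def IsCurveIdealOn (S : SmoothCubicSurface k) (I : Ideal (R4 k)) : Prop :=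
  IsHomogIdeal k I ∧ I.IsPrime ∧ S.f ∈ I ∧
    ringKrullDim (R4 k ⧸ I) = ((2 : ℕ∞) : WithBot ℕ∞)

/-- The Jacobian criterion at a point of the cone: some 2×2 minor of the Jacobian
matrix of elements of `I` is nonzero, i.e. the curve is smooth there. -/
def CurveSmoothAt (I : Ideal (R4 k)) (v : Fin 4 → k) : Prop :=
  ∃ g₁ ∈ I, ∃ g₂ ∈ I, ∃ i j : Fin 4,
    eval v (pderiv i g₁) * eval v (pderiv j g₂)
      - eval v (pderiv j g₁) * eval v (pderiv i g₂) ≠ 0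

/-- A smooth (integral) curve on `X`. -/
def IsSmoothCurveIdealOn (S : SmoothCubicSurface k) (I : Ideal (R4 k)) : Prop :=
  IsCurveIdealOn k S I ∧
  ∀ v : Fin 4 → k, v ≠ 0 → (∀ g ∈ I, eval v g = 0) → CurveSmoothAt k I v

/-- The coordinate ring `R/I` of a curve has depth 2 (a regular sequence of two
positive-degree homogeneous elements), i.e. the curve is arithmetically
Cohen–Macaulay. -/
def IsACMIdeal (I : Ideal (R4 k)) : Prop :=
  ∃ r₁ r₂ : R4 k,
    (∃ d₁ : ℕ, 0 < d₁ ∧ r₁.IsHomogeneous d₁) ∧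
    (∃ d₂ : ℕ, 0 < d₂ ∧ r₂.IsHomogeneous d₂) ∧
    (∀ x : R4 k, r₁ * x ∈ I → x ∈ I) ∧
    (∀ x : R4 k, r₂ * x ∈ I ⊔ Ideal.span {r₁} → x ∈ I ⊔ Ideal.span {r₁})

/-- The Hilbert function `t ↦ dim_k (R/I)_t`. -/
def hilbFn (I : Ideal (R4 k)) (t : ℕ) : ℕ :=
  Module.finrank k ↥(homogeneousSubmodule (Fin 4) k t) -
    Module.finrank k ↥(homogeneousSubmodule (Fin 4) k t ⊓
      Submodule.restrictScalars k I)

/-- The subscheme with saturated ideal `I` has degree `d` and (arithmetic) genus `g`,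
read off from the Hilbert polynomial `P(t) = d·t + 1 - g`. -/
def HasDegreeGenus (I : Ideal (R4 k)) (d : ℕ) (g : ℤ) : Prop :=
  ∃ N : ℕ, ∀ t : ℕ, N ≤ t → (hilbFn k I t : ℤ) = d * t + 1 - g

/-- Linear equivalence of divisors on `X`: the divisor with (divisorial) ideal `I`
is linearly equivalent to (divisor of `J`) + `a·H`, where `H` is the hyperplane
class.  Concretely, there are homogeneous forms `q, p` with `deg p = deg q + a`,
nonzero on `X`, with `q·I = p·J` in `R_X = R/(f)`.  (Taking `J = ⊤` expresses
that the divisor of `I` is linearly equivalent to `aH`.) -/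
def LinEquivOnX (S : SmoothCubicSurface k) (I J : Ideal (R4 k)) (a : ℤ) : Prop :=
  ∃ (mq mp : ℕ) (q p : R4 k), (mp : ℤ) = (mq : ℤ) + a ∧
    q.IsHomogeneous mq ∧ p.IsHomogeneous mp ∧
    q ∉ Ideal.span {S.f} ∧ p ∉ Ideal.span {S.f} ∧
    Ideal.span {q} * I ⊔ Ideal.span {S.f} = Ideal.span {p} * J ⊔ Ideal.span {S.f}

/-- Linear equivalence, on the curve `C` with ideal `IC`, of the divisor with
ideal `IG` to `r·H_C` (`H_C` the hyperplane section of `C`): there are homogeneous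
forms `q, p`, nonzero on `C`, with `deg p = deg q + r` and `q·I_{G,C} = (p)` in
`R/I_C`. -/
def DivOnCurveEquivH (IC IG : Ideal (R4 k)) (r : ℤ) : Prop :=
  ∃ (mq mp : ℕ) (q p : R4 k), (mp : ℤ) = (mq : ℤ) + r ∧
    q.IsHomogeneous mq ∧ p.IsHomogeneous mp ∧ q ∉ IC ∧ p ∉ IC ∧
    Ideal.span {q} * IG ⊔ IC = Ideal.span {p} ⊔ IC

/-- The saturated homogeneous ideal of a zero-dimensional subscheme of `ℙ³`. -/
def IsZeroDimIdeal (I : Ideal (R4 k)) : Prop :=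
  IsHomogIdeal k I ∧ satIdeal k I = I ∧
    ringKrullDim (R4 k ⧸ I) = ((1 : ℕ∞) : WithBot ℕ∞)

/-- An arithmetically Gorenstein zero-dimensional subscheme of `ℙ³`: its ideal has a
graded minimal free resolution of length 3 whose last free module has rank one. -/
def IsAGPointsIdeal (I : Ideal (R4 k)) : Prop :=
  IsZeroDimIdeal k I ∧
  ∃ (n1 n2 : ℕ) (d1 : Fin n1 → ℕ) (d2 : Fin n2 → ℕ) (s : ℕ),
    HasMinFreeRes3 k ⊥ I d1 d2 (fun _ : Fin 1 => s)

/-- `V₁` and `V₂` are directly Gorenstein linked by the arithmetically Gorenstein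
scheme with ideal `IG`: `I_G ⊆ I_{V₁} ∩ I_{V₂}`, `I_G : I_{V₁} = I_{V₂}` and
`I_G : I_{V₂} = I_{V₁}`. -/
def IsGLinked (IG I1 I2 : Ideal (R4 k)) : Prop :=
  IG ≤ I1 ⊓ I2 ∧ icolon k IG I1 = I2 ∧ icolon k IG I2 = I1

/-- The divisor `G` (with ideal `IG`) on the curve `C ⊂ X` (with ideal `IC`) is
linearly equivalent to `m·H_C - K_C`.  By adjunction on the cubic surface
(`K_X = -H`) this says `G + C|_C ∼ (m+1)·H_C` on `C`, where `C|_C` is realized as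
the scheme-theoretic intersection `C ∩ C'` with any curve `C' ∼ C`, `C' ≠ C`,
chosen disjoint from `G`. -/
def EquivHminusKC (S : SmoothCubicSurface k) (IC IG : Ideal (R4 k)) (m : ℤ) : Prop :=
  ∃ IC' : Ideal (R4 k), IsCurveIdealOn k S IC' ∧ IC' ≠ IC ∧
    LinEquivOnX k S IC' IC 0 ∧
    satIdeal k (satIdeal k (IC ⊔ IC') ⊔ IG) = ⊤ ∧
    DivOnCurveEquivH k IC (IG ⊓ satIdeal k (IC ⊔ IC')) (m + 1)

/-- A line on `X`: a smooth integral curve of degree 1, genus 0 on `X`. -/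
def IsLineOn (S : SmoothCubicSurface k) (I : Ideal (R4 k)) : Prop :=
  IsSmoothCurveIdealOn k S I ∧ HasDegreeGenus k I 1 0

/-- A smooth conic on `X`: a smooth integral curve of degree 2, genus 0 on `X`. -/
def IsConicOn (S : SmoothCubicSurface k) (I : Ideal (R4 k)) : Prop :=
  IsSmoothCurveIdealOn k S I ∧ HasDegreeGenus k I 2 0

/-- A twisted cubic on `X`: a smooth integral curve of degree 3, genus 0 on `X`. -/
def IsTwistedCubicOn (S : SmoothCubicSurface k) (I : Ideal (R4 k)) : Prop :=
  IsSmoothCurveIdealOn k S I ∧ HasDegreeGenus k I 3 0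

/-- The curve `C ⊂ X` moves in a linear system of (projective) dimension `dim`,
i.e. `h⁰(O_X(C)) = dim + 1`.  Global sections of `O_X(C)` are computed, for any
homogeneous `q ∈ I_C` of degree `s` not divisible by `f`, as the degree-`s` part of
the colon ideal `((q, f) : I_C)` modulo `(f)`. -/
def MovesInLinSysOfDim (S : SmoothCubicSurface k) (IC : Ideal (R4 k)) (dim : ℤ) : Prop :=
  ∀ (s : ℕ) (q : R4 k), q.IsHomogeneous s → q ∈ IC → q ∉ Ideal.span {S.f} →
    (Module.finrank k ↥(homogeneousSubmodule (Fin 4) k s ⊓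
        Submodule.restrictScalars k (icolon k (Ideal.span {q} ⊔ Ideal.span {S.f}) IC)) : ℤ)
      - (Module.finrank k ↥(homogeneousSubmodule (Fin 4) k s ⊓
        Submodule.restrictScalars k (icolon k (Ideal.span {q} ⊔ Ideal.span {S.f}) IC) ⊓
        Submodule.restrictScalars k (Ideal.span {S.f})) : ℤ) = dim + 1

/-- `I/(f₀)` is a maximal Cohen–Macaulay module over `R/(f₀)` (3-dimensional):
it admits a regular sequence of three positive-degree homogeneous elements. -/
def IsMCMQuotient (f0 : R4 k) (I : Ideal (R4 k)) : Prop :=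
  ∃ r₁ r₂ r₃ : R4 k,
    (∃ d : ℕ, 0 < d ∧ r₁.IsHomogeneous d) ∧
    (∃ d : ℕ, 0 < d ∧ r₂.IsHomogeneous d) ∧
    (∃ d : ℕ, 0 < d ∧ r₃.IsHomogeneous d) ∧
    (∀ x ∈ I, r₁ * x ∈ Ideal.span {f0} → x ∈ Ideal.span {f0}) ∧
    (∀ x ∈ I, r₂ * x ∈ Ideal.span {r₁} * I ⊔ Ideal.span {f0} →
      x ∈ Ideal.span {r₁} * I ⊔ Ideal.span {f0}) ∧
    (∀ x ∈ I, r₃ * x ∈ Ideal.span {r₁} * I ⊔ Ideal.span {r₂} * I ⊔ Ideal.span {f0} →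
      x ∈ Ideal.span {r₁} * I ⊔ Ideal.span {r₂} * I ⊔ Ideal.span {f0}) ∧
    (∃ x ∈ I, x ∉ Ideal.span {r₁} * I ⊔ Ideal.span {r₂} * I ⊔ Ideal.span {r₃} * I
      ⊔ Ideal.span {f0})

end

section

variable {k : Type} [Field k]

lemma IsHomogIdeal.homogeneousComponent_mem {I : Ideal (R4 k)} (hI : IsHomogIdeal k I)
    {x : R4 k} (hx : x ∈ I) (n : ℕ) : homogeneousComponent n x ∈ I := by
  obtain ⟨G, hG, rfl⟩ := hI
  let := MvPolynomial.gradedAlgebra (σ := Fin 4) (R := k)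
  exact homogeneousComponent_mem_of_mem
    (Ideal.homogeneous_span (homogeneousSubmodule (Fin 4) k) G hG) hx n

lemma homogeneousComponent_mul_add {q : R4 k} {m : ℕ} (hq : q.IsHomogeneous m) (b : R4 k)
    (n : ℕ) : homogeneousComponent (m + n) (q * b) = q * homogeneousComponent n b := by
  let := MvPolynomial.gradedAlgebra (σ := Fin 4) (R := k)
  have h := DirectSum.coe_decompose_mul_add_of_left_mem (homogeneousSubmodule (Fin 4) k)
    (j := n) (b := b) hq
  exact (decomposition.decompose'_apply _ _).symm.trans
    (h.trans (congrArg (q * ·) (decomposition.decompose'_apply b n)))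

/-- If `q J = (p)` modulo a homogeneous prime `I ⊆ J`, with `q`, `p` forms outside `I`, then
modulo `I` the ideal `J` is generated by a single form of degree `deg p - deg q`. -/
lemma exists_homogeneous_generator_mod_prime {I J : Ideal (R4 k)} (hI : IsHomogIdeal k I)
    (hprime : I.IsPrime) (hIJ : I ≤ J) {q p : R4 k} {m a : ℕ} (hq : q.IsHomogeneous m)
    (hp : p.IsHomogeneous (m + a)) (hqI : q ∉ I) (hpI : p ∉ I)
    (h : Ideal.span {q} * J ⊔ I = Ideal.span {p} ⊔ I) :
    ∃ g : R4 k, g.IsHomogeneous a ∧ g ∉ I ∧ J = Ideal.span {g} ⊔ I := by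
  have hpJ : p ∈ Ideal.span {q} * J ⊔ I :=
    h ▸ Ideal.mem_sup_left (Ideal.mem_span_singleton_self p)
  obtain ⟨y, hy, z, hz, hyz⟩ := Submodule.mem_sup.1 hpJ
  obtain ⟨b, hb, rfl⟩ := Ideal.mem_span_singleton_mul.1 hy
  have hcomp : p = q * homogeneousComponent a b + homogeneousComponent (m + a) z := by
    have := congrArg (homogeneousComponent (m + a)) hyz
    rw [map_add, homogeneousComponent_of_mem hp, if_pos rfl,
      homogeneousComponent_mul_add hq] at this
    exact this.symm
  have hzI := hI.homogeneousComponent_mem hz (m + a)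
  set g := homogeneousComponent a b with hg
  have hbg : b - g ∈ I := by
    refine (hprime.mem_or_mem (x := q) ?_).resolve_left hqI
    have : q * (b - g) = homogeneousComponent (m + a) z - z := by linear_combination hyz + hcomp
    exact this ▸ I.sub_mem hzI hz
  have hgJ : g ∈ J := by
    have := J.sub_mem hb (hIJ hbg)
    rwa [sub_sub_cancel] at this
  refine ⟨g, homogeneousComponent_isHomogeneous a b, fun hgI => hpI ?_, le_antisymm ?_ ?_⟩
  · rw [hcomp]
    exact I.add_mem (I.mul_mem_left q hgI) hzI
  · intro x hx
    have hqx : q * x ∈ Ideal.span {p} ⊔ I :=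
      h ▸ Ideal.mem_sup_left (Ideal.mul_mem_mul (Ideal.mem_span_singleton_self q) hx)
    obtain ⟨c, w, hw, hcw⟩ := Ideal.mem_span_singleton_sup.1 hqx
    refine Ideal.mem_span_singleton_sup.2 ⟨c, x - c * g, ?_, by ring⟩
    refine (hprime.mem_or_mem (x := q) ?_).resolve_left hqI
    have : q * (x - c * g) = c * homogeneousComponent (m + a) z + w := by
      linear_combination c * hcomp - hcw
    exact this ▸ I.add_mem (I.mul_mem_left c hzI) hw
  · exact sup_le ((Ideal.span_singleton_le_iff_mem J).2 hgJ) hIJ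

lemma MvPolynomial.IsHomogeneous.entryOk {q : R4 k} {c d e : ℕ} (hq : q.IsHomogeneous c)
    (hc : c ≠ 0) (hd : d = e + c) : EntryOk k d e q :=
  ⟨Or.inr ⟨c, hd, hq⟩, hq.coeff_eq_zero (by simpa using hc.symm)⟩

lemma entryOk_zero (d e : ℕ) : EntryOk k d e 0 := ⟨Or.inl rfl, coeff_zero 0⟩

/-- The Koszul resolution of an ideal generated by a regular sequence `f, g, h` of forms of
positive degree, where `(f)` and `(f, g)` are prime. -/
lemma hasMinFreeRes3_koszul {f g h : R4 k} {a b c : ℕ} (ha : a ≠ 0) (hb : b ≠ 0) (hc : c ≠ 0)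
    (hg : g.IsHomogeneous a) (hh : h.IsHomogeneous b) (hf : f.IsHomogeneous c)
    (hfp : Prime f) (hgf : g ∉ Ideal.span {f})
    (hfg : (Ideal.span {g} ⊔ Ideal.span {f}).IsPrime)
    (hhfg : h ∉ Ideal.span {g} ⊔ Ideal.span {f}) :
    HasMinFreeRes3 k ⊥ (Ideal.span {h} ⊔ (Ideal.span {g} ⊔ Ideal.span {f}))
      ![a, b, c] ![a + b, a + c, b + c] (fun _ : Fin 1 => a + b + c) := by
  rw [Ideal.mem_span_singleton] at hgf
  refine ⟨![g, h, f], ![![h, -g, 0], ![f, 0, -g], ![0, f, -h]], ![![f, -h, g]],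
    ?_, ?_, ?_, ?_, ?_, ?_, ?_⟩
  · intro j
    fin_cases j
    · exact ⟨Ideal.mem_sup_right (Ideal.mem_sup_left (Ideal.mem_span_singleton_self g)), hg⟩
    · exact ⟨Ideal.mem_sup_left (Ideal.mem_span_singleton_self h), hh⟩
    · exact ⟨Ideal.mem_sup_right (Ideal.mem_sup_right (Ideal.mem_span_singleton_self f)), hf⟩
  · intro x hx
    obtain ⟨v, y, hy, rfl⟩ := Ideal.mem_span_singleton_sup.1 hx
    obtain ⟨u, z, hz, rfl⟩ := Ideal.mem_span_singleton_sup.1 hy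
    obtain ⟨w, rfl⟩ := Ideal.mem_span_singleton'.1 hz
    refine ⟨![u, v, w], ?_⟩
    simp [Fin.sum_univ_three]
    ring
  · intro i j
    fin_cases i <;> fin_cases j
    · exact hh.entryOk hb rfl
    · exact hg.neg.entryOk ha (add_comm a b)
    · exact entryOk_zero _ _
    · exact hf.entryOk hc rfl
    · exact entryOk_zero _ _
    · exact hg.neg.entryOk ha (add_comm a c)
    · exact entryOk_zero _ _
    · exact hf.entryOk hc rfl
    · exact hh.neg.entryOk hb (add_comm b c)
  · intro i j
    fin_cases i
    fin_cases j
    · exact hf.entryOk hc rfl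
    · exact hh.neg.entryOk hb (add_right_comm a b c)
    · exact hg.entryOk ha ((add_assoc a b c).trans (add_comm a (b + c)))
  · intro w
    simp only [Fin.sum_univ_three, Ideal.mem_bot, Fin.forall_fin_succ, IsEmpty.forall_iff]
    simp
    constructor
    · intro hw
      have hw1 : w 1 ∈ Ideal.span {g} ⊔ Ideal.span {f} := by
        refine (hfg.mem_or_mem (y := h) ?_).resolve_right hhfg
        refine Ideal.mem_span_singleton_sup.2 ⟨-w 0, -w 2 * f, ?_, by linear_combination -hw⟩
        exact Ideal.mul_mem_left _ _ (Ideal.mem_span_singleton_self f)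
      obtain ⟨s, y, hy, hsy⟩ := Ideal.mem_span_singleton_sup.1 hw1
      obtain ⟨t, rfl⟩ := Ideal.mem_span_singleton'.1 hy
      obtain ⟨r, hr⟩ : f ∣ w 0 + s * h :=
        (hfp.dvd_or_dvd (b := g) ⟨-w 2 - t * h, by linear_combination hw + h * hsy⟩).resolve_right
          hgf
      refine ⟨![-s, r, t], ?_, ?_, ?_⟩ <;> simp
      · linear_combination hr
      · linear_combination -hsy
      · refine mul_left_cancel₀ hfp.ne_zero ?_
        linear_combination hw + h * hsy - g * hr
    · rintro ⟨u, h0, h1, h2⟩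
      linear_combination g * h0 + h * h1 + f * h2
  · intro u
    simp only [Fin.sum_univ_three, Fin.forall_fin_succ, IsEmpty.forall_iff]
    simp
    constructor
    · rintro ⟨h0, h1, h2⟩
      obtain ⟨t, ht⟩ : f ∣ u 0 :=
        (hfp.dvd_or_dvd (b := g) ⟨u 2, by linear_combination -h1⟩).resolve_right hgf
      refine ⟨fun _ => t, ?_, ?_, ?_⟩
      · linear_combination ht
      · refine mul_left_cancel₀ hfp.ne_zero ?_
        linear_combination h0 - h * ht
      · refine mul_left_cancel₀ hfp.ne_zero ?_
        linear_combination h1 + g * ht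
    · rintro ⟨t, h0, h1, h2⟩
      rw [h0, h1, h2]
      refine ⟨?_, ?_, ?_⟩ <;> ring
  · intro t ht
    have h0 := ht 0
    simp [hfp.ne_zero] at h0
    funext l
    rw [Subsingleton.elim l 0, h0, Pi.zero_apply]

end

/-- Let `C` be a smooth curve `∼ aH` on `X` (`a ≥ 2`) and `G` an
arithmetically Gorenstein set of points on `C` with `G ∼ a·H_C`.  Then the graded minimal free
`R`-resolution of `I_G` is
`0 → R(-2a-3) → R(-2a) ⊕ R(-a-3)² → R(-a)² ⊕ R(-3) → I_G → 0`. -/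
theorem resolution_complete_intersection_link (k : Type) [Field k] [IsAlgClosed k]
    (S : SmoothCubicSurface k) (a : ℕ) (ha : 2 ≤ a)
    (IC : Ideal (R4 k)) (hC : IsSmoothCurveIdealOn k S IC)
    (hlin : LinEquivOnX k S IC ⊤ (a : ℤ))
    (IG : Ideal (R4 k)) (hGC : IC ≤ IG) (hG0 : IsZeroDimIdeal k IG)
    (hAG : IsAGPointsIdeal k IG)
    (hGH : DivOnCurveEquivH k IC IG (a : ℤ)) :
    HasMinFreeRes3 k ⊥ IG
      (![a, a, 3])
      (![2 * a, a + 3, a + 3])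
      (fun _ : Fin (1) => 2 * a + 3) := by
  have hfp : Prime S.f := S.irred.prime
  have hfI : (Ideal.span {S.f}).IsPrime := (Ideal.span_singleton_prime hfp.ne_zero).2 hfp
  have hfhom : IsHomogIdeal k (Ideal.span {S.f}) :=
    ⟨{S.f}, fun g hg => ⟨3, (Set.mem_singleton_iff.1 hg) ▸ S.homog⟩, rfl⟩
  obtain ⟨hIChom, hICprime, hfIC, -⟩ := hC.1
  have ha0 : a ≠ 0 := by omega
  obtain ⟨g, hg, hgf, hICg⟩ : ∃ g : R4 k, g.IsHomogeneous a ∧ g ∉ Ideal.span {S.f} ∧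
      IC = Ideal.span {g} ⊔ Ideal.span {S.f} := by
    obtain ⟨mq, mp, q, p, hdeg, hq, hp, hqf, hpf, h⟩ := hlin
    obtain rfl : mp = mq + a := by omega
    rw [Ideal.mul_top] at h
    exact exists_homogeneous_generator_mod_prime hfhom hfI
      ((Ideal.span_singleton_le_iff_mem IC).2 hfIC) hq hp hqf hpf h
  obtain ⟨h, hh, hhIC, hIGh⟩ : ∃ h : R4 k, h.IsHomogeneous a ∧ h ∉ IC ∧
      IG = Ideal.span {h} ⊔ IC := by
    obtain ⟨mq, mp, q, p, hdeg, hq, hp, hqC, hpC, h⟩ := hGH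
    obtain rfl : mp = mq + a := by omega
    exact exists_homogeneous_generator_mod_prime hIChom hICprime hGC hq hp hqC hpC h
  subst hICg hIGh
  rw [two_mul]
  exact hasMinFreeRes3_koszul ha0 ha0 three_ne_zero hg hh S.homog hfp hgf hICprime hhIC
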